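/- arXiv:2409.08727 — 2 statements merged into one kernel-verified Lean document; each statement's English description precedes it below -/
import Mathlib

section
/- Let B be a strong bimonoid. The following three statements are equivalent: (1) B is right-distributive; (2) for every alphabet Γ and every weighted automaton A over Γ and B, the image of ⟦A⟧^run equals the image of ⟦A⟧^init; (3) for every alphabet Γ and every weighted automaton A over Γ and B, ⟦A⟧^run = ⟦A⟧^init. -/
/-! Strong bimonoids -/

structure StrongBimonoid (B : Type) where
  add : B → B → B
  mul : B → B → B
  zero : B
  one : B
  add_assoc : ∀ a b c, add (add a b) c = add a (add b c)
  add_comm : ∀ a b, add a b = add b a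
  add_zero : ∀ a, add a zero = a
  mul_assoc : ∀ a b c, mul (mul a b) c = mul a (mul b c)
  one_mul : ∀ a, mul one a = a
  mul_one : ∀ a, mul a one = a
  zero_mul : ∀ a, mul zero a = zero
  mul_zero : ∀ a, mul a zero = zero

namespace StrongBimonoid

variable {B : Type} (S : StrongBimonoid B)

/-- The additive commutative monoid underlying a strong bimonoid. -/
def acm : AddCommMonoid B where
  add := S.add
  zero := S.zero
  add_assoc := S.add_assoc
  zero_add := fun a => (S.add_comm S.zero a).trans (S.add_zero a)
  add_zero := S.add_zero
  add_comm := S.add_comm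
  nsmul := fun n a => Nat.rec S.zero (fun _ ih => S.add ih a) n
  nsmul_zero := fun _ => rfl
  nsmul_succ := fun _ _ => rfl

/-- Finite sum (w.r.t. `S.add`, `S.zero`) of `f` over a finite index set. -/
def fsum {ι : Type} (t : Finset ι) (f : ι → B) : B :=
  @Finset.sum ι B S.acm t f

/-- Ordered product `f 0 ⊗ f 1 ⊗ ⋯ ⊗ f (k-1)` (empty product is `S.one`). -/
def finProd : {k : ℕ} → (Fin k → B) → B
  | 0, _ => S.one
  | _ + 1, f => S.mul (f 0) (finProd (fun i => f i.succ))

def ZeroSumFree : Prop :=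
  ∀ a b, S.add a b = S.zero → a = S.zero ∧ b = S.zero

def StronglyZeroSumFree : Prop :=
  ∀ a b c, S.mul (S.add a b) c = S.zero ↔ (S.mul a c = S.zero ∧ S.mul b c = S.zero)

def BiStronglyZeroSumFree : Prop :=
  ∀ a b b' c, S.mul (S.mul a (S.add b b')) c = S.zero ↔
    (S.mul (S.mul a b) c = S.zero ∧ S.mul (S.mul a b') c = S.zero)

def ZeroDivisorFree : Prop :=
  ∀ a b, S.mul a b = S.zero ↔ (a = S.zero ∨ b = S.zero)

def Positive : Prop := S.ZeroSumFree ∧ S.ZeroDivisorFree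

def RightDistributive : Prop :=
  ∀ a b c, S.mul (S.add a b) c = S.add (S.mul a c) (S.mul b c)

def LeftDistributive : Prop :=
  ∀ a b c, S.mul a (S.add b c) = S.add (S.mul a b) (S.mul a c)

def ZeroRightDistributive : Prop :=
  ∀ a b c, (S.mul (S.add a b) c = S.zero ↔ S.add (S.mul a c) (S.mul b c) = S.zero)

def CommutativeMul : Prop := ∀ a b, S.mul a b = S.mul b a

end StrongBimonoid

/-! Weighted automata over words -/

section Word

variable {B : Type} {Γ : Type} {Q : Type}

/-- The product `μ(a₁)_{ρ₀,ρ₁} ⊗ ⋯ ⊗ μ(aₙ)_{ρₙ₋₁,ρₙ}` of the transition weights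
along the run `ρ` on the word `w = a₁⋯aₙ`. -/
def transProd (S : StrongBimonoid B) (μ : Γ → Q → Q → B) :
    (w : List Γ) → (Fin (w.length + 1) → Q) → B
  | [], _ => S.one
  | a :: w, ρ => S.mul (μ a (ρ 0) (ρ 1)) (transProd S μ w (fun i => ρ i.succ))

/-- Run semantics of the weighted automaton `(Q, I, μ, F)` over `Γ` and `S`. -/
def runSem (S : StrongBimonoid B) [Fintype Q] (I : Q → B) (μ : Γ → Q → Q → B)
    (F : Q → B) (w : List Γ) : B :=
  S.fsum Finset.univ (fun ρ : Fin (w.length + 1) → Q =>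
    S.mul (S.mul (I (ρ 0)) (transProd S μ w ρ)) (F (ρ (Fin.last w.length))))

/-- `hWord S μ w v` is the vector `v ⊗ μ(a₁) ⊗ ⋯ ⊗ μ(aₙ)` (left-associated
vector-matrix products) for `w = a₁⋯aₙ`. -/
def hWord (S : StrongBimonoid B) [Fintype Q] (μ : Γ → Q → Q → B) :
    List Γ → (Q → B) → (Q → B)
  | [], v => v
  | a :: w, v =>
      hWord S μ w (fun q => S.fsum Finset.univ (fun p => S.mul (v p) (μ a p q)))

/-- Initial algebra semantics of the weighted automaton `(Q, I, μ, F)`. -/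
def initSem (S : StrongBimonoid B) [Fintype Q] (I : Q → B) (μ : Γ → Q → Q → B)
    (F : Q → B) (w : List Γ) : B :=
  S.fsum Finset.univ (fun q => S.mul (hWord S μ w I q) (F q))

end Word

/-! Ranked alphabets, trees and weighted tree automata -/

/-- Trees over the ranked alphabet `(σ, rk)`: a node labelled `s` has exactly
`rk s` children. -/
inductive RTree (σ : Type) (rk : σ → ℕ) : Type where
  | node (s : σ) (ts : Fin (rk s) → RTree σ rk) : RTree σ rk

/-- The ranked alphabet is trivial if all symbols have rank 0. -/
def RankTrivial {σ : Type} (rk : σ → ℕ) : Prop := ∀ s, rk s = 0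

/-- The ranked alphabet is branching if some symbol has rank ≥ 2. -/
def RankBranching {σ : Type} (rk : σ → ℕ) : Prop := ∃ s, 2 ≤ rk s

/-- A run of an automaton with state set `Q` on a tree: an assignment of a
state to every position of the tree. -/
inductive TreeRun (σ : Type) (rk : σ → ℕ) (Q : Type) : RTree σ rk → Type where
  | node {s : σ} {ts : Fin (rk s) → RTree σ rk} (q : Q)
      (rs : (i : Fin (rk s)) → TreeRun σ rk Q (ts i)) :
      TreeRun σ rk Q (RTree.node s ts)

/-- The state assigned by a run to the root. -/
def TreeRun.root {σ : Type} {rk : σ → ℕ} {Q : Type} {t : RTree σ rk} :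
    TreeRun σ rk Q t → Q
  | .node q _ => q

def treeRunFintype {σ : Type} {rk : σ → ℕ} (Q : Type) [Fintype Q] :
    (t : RTree σ rk) → Fintype (TreeRun σ rk Q t)
  | RTree.node s ts =>
    letI : ∀ i, Fintype (TreeRun σ rk Q (ts i)) := fun i => treeRunFintype Q (ts i)
    Fintype.ofEquiv (Q × ((i : Fin (rk s)) → TreeRun σ rk Q (ts i)))
      { toFun := fun p => TreeRun.node p.1 p.2
        invFun := fun r => match r with | TreeRun.node q rs => (q, rs)
        left_inv := fun _ => rfl
        right_inv := fun r => match r with | TreeRun.node _ _ => rfl }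

instance {σ : Type} {rk : σ → ℕ} {Q : Type} [Fintype Q] (t : RTree σ rk) :
    Fintype (TreeRun σ rk Q t) := treeRunFintype Q t

/-- The weight of a run on a tree. -/
def treeWt {B : Type} {σ : Type} {rk : σ → ℕ} {Q : Type} (S : StrongBimonoid B)
    (δ : (s : σ) → (Fin (rk s) → Q) → Q → B) :
    (t : RTree σ rk) → TreeRun σ rk Q t → B
  | _, TreeRun.node (s := s) (ts := ts) q rs =>
      S.mul (S.finProd (fun i => treeWt S δ (ts i) (rs i)))
        (δ s (fun i => (rs i).root) q)

/-- Run semantics of the weighted tree automaton `(Q, δ, F)`. -/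
def treeRunSem {B : Type} {σ : Type} {rk : σ → ℕ} {Q : Type} (S : StrongBimonoid B)
    [Fintype Q] (δ : (s : σ) → (Fin (rk s) → Q) → Q → B) (F : Q → B)
    (t : RTree σ rk) : B :=
  S.fsum Finset.univ (fun ρ : TreeRun σ rk Q t => S.mul (treeWt S δ t ρ) (F ρ.root))

/-- The map `h_A : T_Σ → B^Q` of the initial algebra semantics. -/
def treeH {B : Type} {σ : Type} {rk : σ → ℕ} {Q : Type} (S : StrongBimonoid B)
    [Fintype Q] (δ : (s : σ) → (Fin (rk s) → Q) → Q → B) :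
    RTree σ rk → Q → B
  | RTree.node s ts => fun q =>
      S.fsum Finset.univ (fun qs : Fin (rk s) → Q =>
        S.mul (S.finProd (fun i => treeH S δ (ts i) (qs i))) (δ s qs q))

/-- Initial algebra semantics of the weighted tree automaton `(Q, δ, F)`. -/
def treeInitSem {B : Type} {σ : Type} {rk : σ → ℕ} {Q : Type} (S : StrongBimonoid B)
    [Fintype Q] (δ : (s : σ) → (Fin (rk s) → Q) → Q → B) (F : Q → B)
    (t : RTree σ rk) : B :=
  S.fsum Finset.univ (fun q => S.mul (treeH S δ t q) (F q))


namespace StrongBimonoid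

variable {B : Type} (S : StrongBimonoid B)

theorem zero_add (x : B) : S.add S.zero x = x :=
  (S.add_comm _ _).trans (S.add_zero x)

theorem fsum_eq_zero {ι : Type} (t : Finset ι) (f : ι → B) (h : ∀ i ∈ t, f i = S.zero) :
    S.fsum t f = S.zero :=
  letI := S.acm
  Finset.sum_eq_zero h

/-- Right distributivity extends to finite sums. -/
theorem RightDistributive.fsum_mul {S : StrongBimonoid B} (hS : S.RightDistributive)
    {ι : Type} (t : Finset ι) (f : ι → B) (c : B) :
    S.mul (S.fsum t f) c = S.fsum t (fun i => S.mul (f i) c) := by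
  let := S.acm
  let g : B →+ B :=
    { toFun := fun x => S.mul x c
      map_zero' := S.zero_mul c
      map_add' := fun x y => hS x y c }
  exact map_sum g f t

theorem fsum_fin_succ_pi {Q : Type} [Fintype Q] {n : ℕ} (f : (Fin (n + 1) → Q) → B) :
    S.fsum Finset.univ f =
      S.fsum Finset.univ (fun ρ : Fin n → Q =>
        S.fsum Finset.univ (fun p : Q => f (Fin.cons p ρ))) := by
  let := S.acm
  change ∑ ρ, f ρ = ∑ ρ : Fin n → Q, ∑ p : Q, f (Fin.cons p ρ)
  rw [← (Fin.consEquiv (fun _ : Fin (n + 1) => Q)).sum_comp, Fintype.sum_prod_type,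
    Finset.sum_comm]
  rfl

end StrongBimonoid

/-- Over a right-distributive strong bimonoid, reading a letter amounts to updating the
initial vector. -/
theorem runSem_cons {B Γ Q : Type} {S : StrongBimonoid B} (hS : S.RightDistributive)
    [Fintype Q] (I : Q → B) (μ : Γ → Q → Q → B) (F : Q → B) (a : Γ) (w : List Γ) :
    runSem S I μ F (a :: w) =
      runSem S (fun q => S.fsum Finset.univ (fun p => S.mul (I p) (μ a p q))) μ F w := by
  refine (S.fsum_fin_succ_pi _).trans (congrArg (S.fsum Finset.univ) (funext fun ρ => ?_))
  rw [hS.fsum_mul, hS.fsum_mul]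
  refine congrArg (S.fsum Finset.univ) (funext fun p => ?_)
  rw [S.mul_assoc (I p) (μ a p (ρ 0))]
  rfl

theorem runSem_nil {B Γ Q : Type} (S : StrongBimonoid B) [Fintype Q] (I : Q → B)
    (μ : Γ → Q → Q → B) (F : Q → B) :
    runSem S I μ F [] = S.fsum Finset.univ (fun q => S.mul (I q) (F q)) := by
  let := S.acm
  refine ((Equiv.funUnique (Fin 1) Q).symm.sum_comp _).symm.trans
    (Finset.sum_congr rfl fun q _ => ?_)
  exact congrArg (fun x => S.mul x (F q)) (S.mul_one (I q))

theorem StrongBimonoid.RightDistributive.runSem_eq_initSem {B Γ Q : Type}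
    {S : StrongBimonoid B} (hS : S.RightDistributive) [Fintype Q] (I : Q → B)
    (μ : Γ → Q → Q → B) (F : Q → B) : runSem S I μ F = initSem S I μ F := by
  funext w
  induction w generalizing I with
  | nil => exact runSem_nil S I μ F
  | cons a w ih => exact (runSem_cons hS I μ F a w).trans (ih _)

section Layered

variable {B : Type} (S : StrongBimonoid B) (a b c : B)

/-- Initial weights of an automaton with two initial states `some true`, `some false`
and one final state `none`. -/
def layeredInit : Option Bool → B
  | none => S.zero
  | some true => a
  | some false => b

/-- Transitions from both initial states to the final state, with weight one. -/
def layeredTrans : Unit → Option Bool → Option Bool → B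
  | _, some _, none => S.one
  | _, _, _ => S.zero

/-- Final weights, supported on the final state. -/
def layeredFinal : Option Bool → B
  | none => c
  | some _ => S.zero

theorem fsum_option_bool (f : Option Bool → B) :
    S.fsum Finset.univ f = S.add (f none) (S.add (f (some true)) (f (some false))) := by
  let := S.acm
  change ∑ q, f q = f none + (f (some true) + f (some false))
  rw [Fintype.sum_option, Fintype.sum_bool]

theorem layered_initSem_nil :
    initSem S (layeredInit S a b) (layeredTrans S) (layeredFinal S c) [] = S.zero := by
  simp [initSem, hWord, fsum_option_bool, layeredInit, layeredFinal, S.zero_mul, S.mul_zero,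
    S.add_zero]

theorem layered_initSem_singleton :
    initSem S (layeredInit S a b) (layeredTrans S) (layeredFinal S c) [()] =
      S.mul (S.add a b) c := by
  simp [initSem, hWord, fsum_option_bool, layeredInit, layeredTrans, layeredFinal, S.zero_mul,
    S.mul_zero, S.mul_one, S.add_zero, S.zero_add]

theorem hWord_zero {Γ Q : Type} [Fintype Q] (μ : Γ → Q → Q → B) (w : List Γ) :
    hWord S μ w (fun _ => S.zero) = fun _ => S.zero := by
  induction w with
  | nil => rfl
  | cons x w ih =>
    rw [hWord]
    convert ih using 2
    funext q
    exact S.fsum_eq_zero _ _ fun p _ => S.zero_mul _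

theorem layered_initSem_cons_cons (w : List Unit) :
    initSem S (layeredInit S a b) (layeredTrans S) (layeredFinal S c) (() :: () :: w) =
      S.zero := by
  have h : hWord S (layeredTrans S) (() :: () :: w) (layeredInit S a b) =
      fun _ => S.zero := by
    rw [hWord, hWord]
    convert hWord_zero S (layeredTrans S) w using 2
    funext q
    rcases q with _ | q <;>
      simp [fsum_option_bool, layeredInit, layeredTrans, S.zero_mul, S.mul_zero, S.add_zero]
  rw [initSem, h]
  exact S.fsum_eq_zero _ _ fun p _ => S.zero_mul _

theorem layered_runSem_nil :
    runSem S (layeredInit S a b) (layeredTrans S) (layeredFinal S c) [] = S.zero :=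
  (runSem_nil S _ _ _).trans (layered_initSem_nil S a b c)

theorem layered_runSem_singleton :
    runSem S (layeredInit S a b) (layeredTrans S) (layeredFinal S c) [()] =
      S.add (S.mul a c) (S.mul b c) := by
  refine (S.fsum_fin_succ_pi _).trans ?_
  let := S.acm
  refine ((Equiv.funUnique (Fin 1) (Option Bool)).symm.sum_comp _).symm.trans ?_
  change S.fsum Finset.univ (fun q => S.fsum Finset.univ (fun p =>
    S.mul (S.mul (layeredInit S a b p) (S.mul (layeredTrans S () p q) S.one))
      (layeredFinal S c q))) = _
  simp [fsum_option_bool, layeredInit, layeredTrans, layeredFinal, S.zero_mul,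
    S.mul_zero, S.mul_one, S.add_zero, S.zero_add]

theorem layered_runSem_cons_cons (w : List Unit) :
    runSem S (layeredInit S a b) (layeredTrans S) (layeredFinal S c) (() :: () :: w) =
      S.zero := by
  refine S.fsum_eq_zero _ _ fun ρ _ => ?_
  change S.mul (S.mul _ (S.mul (layeredTrans S () (ρ 0) (ρ 1))
    (S.mul (layeredTrans S () (ρ 1) (ρ 2)) _))) _ = S.zero
  rcases ρ 1 with _ | q
  · simp [layeredTrans, S.zero_mul, S.mul_zero]
  · rcases ρ 0 with _ | p <;> simp [layeredTrans, S.zero_mul, S.mul_zero]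

theorem range_of_singleton_support {r : List Unit → B} {z x : B} (h0 : r [] = z)
    (h1 : r [()] = x) (h2 : ∀ w, r (() :: () :: w) = z) : Set.range r = {z, x} := by
  apply Set.Subset.antisymm
  · rintro _ ⟨w, rfl⟩
    match w with
    | [] => exact Or.inl h0
    | [()] => exact Or.inr h1
    | () :: () :: w => exact Or.inl (h2 w)
  · rintro _ (rfl | rfl)
    exacts [⟨_, h0⟩, ⟨_, h1⟩]

theorem add_mul_eq_of_range_layered_eq
    (h : Set.range (runSem S (layeredInit S a b) (layeredTrans S) (layeredFinal S c)) =
      Set.range (initSem S (layeredInit S a b) (layeredTrans S) (layeredFinal S c))) :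
    S.mul (S.add a b) c = S.add (S.mul a c) (S.mul b c) := by
  rw [range_of_singleton_support (layered_runSem_nil S a b c)
      (layered_runSem_singleton S a b c) (layered_runSem_cons_cons S a b c),
    range_of_singleton_support (layered_initSem_nil S a b c)
      (layered_initSem_singleton S a b c) (layered_initSem_cons_cons S a b c)] at h
  simp only [Set.ext_iff, Set.mem_insert_iff, Set.mem_singleton_iff] at h
  have hr := h (S.add (S.mul a c) (S.mul b c))
  have hi := h (S.mul (S.add a b) c)
  grind

end Layered

theorem stmt5 {B : Type} (S : StrongBimonoid B) :
    (S.RightDistributive ↔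
      (∀ (Γ : Type) [Fintype Γ] [Nonempty Γ],
        ∀ (Q : Type) [Fintype Q] [Nonempty Q] (I : Q → B) (μ : Γ → Q → Q → B) (F : Q → B),
          Set.range (runSem S I μ F) = Set.range (initSem S I μ F))) ∧
    ((∀ (Γ : Type) [Fintype Γ] [Nonempty Γ],
        ∀ (Q : Type) [Fintype Q] [Nonempty Q] (I : Q → B) (μ : Γ → Q → Q → B) (F : Q → B),
          Set.range (runSem S I μ F) = Set.range (initSem S I μ F)) ↔
      (∀ (Γ : Type) [Fintype Γ] [Nonempty Γ],
        ∀ (Q : Type) [Fintype Q] [Nonempty Q] (I : Q → B) (μ : Γ → Q → Q → B) (F : Q → B),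
          runSem S I μ F = initSem S I μ F)) := by
  have hdist : (∀ (Γ : Type) [Fintype Γ] [Nonempty Γ],
        ∀ (Q : Type) [Fintype Q] [Nonempty Q] (I : Q → B) (μ : Γ → Q → Q → B) (F : Q → B),
          Set.range (runSem S I μ F) = Set.range (initSem S I μ F)) → S.RightDistributive :=
    fun h a b c => add_mul_eq_of_range_layered_eq S a b c (h Unit (Option Bool) _ _ _)
  refine ⟨⟨fun hS Γ _ _ Q _ _ I μ F => ?_, hdist⟩,
    ⟨fun h Γ _ _ Q _ _ I μ F => (hdist h).runSem_eq_initSem I μ F,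
      fun h Γ _ _ Q _ _ I μ F => ?_⟩⟩
  · rw [hS.runSem_eq_initSem]
  · rw [h]
end

section
/- Let Σ be a ranked alphabet and B be a zero-sum-free strong bimonoid. Then the following two statements are equivalent: (1) if Σ is not trivial, then for all b,b',c ∈ B, (b ⊕ b') ⊗ c ≠ 𝟘 implies b ⊗ c ≠ 𝟘 or b' ⊗ c ≠ 𝟘, and if Σ is branching, then for all a,b,b',c ∈ B, a ⊗ (b ⊕ b') ⊗ c ≠ 𝟘 implies a ⊗ b ⊗ c ≠ 𝟘 or a ⊗ b' ⊗ c ≠ 𝟘; (2) for each weighted tree automaton A over Σ and B, supp(⟦A⟧^init) ⊆ supp(⟦A⟧^run). -/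
namespace StrongBimonoid

variable {B : Type} (S : StrongBimonoid B)

theorem fsum_empty {ι : Type} (f : ι → B) : S.fsum ∅ f = S.zero :=
  @Finset.sum_empty ι B f S.acm

theorem fsum_insert {ι : Type} [DecidableEq ι] {t : Finset ι} {i : ι} (h : i ∉ t) (f : ι → B) :
    S.fsum (insert i t) f = S.add (f i) (S.fsum t f) :=
  letI := S.acm
  Finset.sum_insert h

theorem fsum_eq_single {ι : Type} [Fintype ι] {f : ι → B} (i : ι)
    (h : ∀ j, j ≠ i → f j = S.zero) : S.fsum Finset.univ f = f i :=
  letI := S.acm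
  Fintype.sum_eq_single i h

theorem fsum_eq_add {ι : Type} [Fintype ι] {f : ι → B} (i j : ι) (hij : i ≠ j)
    (h : ∀ k, k ≠ i ∧ k ≠ j → f k = S.zero) :
    S.fsum Finset.univ f = S.add (f i) (f j) :=
  letI := S.acm
  Fintype.sum_eq_add i j hij h

theorem exists_ne_zero_of_fsum_ne_zero {ι : Type} {t : Finset ι} {f : ι → B}
    (h : S.fsum t f ≠ S.zero) : ∃ i ∈ t, f i ≠ S.zero :=
  letI := S.acm
  Finset.exists_ne_zero_of_sum_ne_zero h

theorem ZeroSumFree.eq_zero_of_fsum_eq_zero {S : StrongBimonoid B} (hS : S.ZeroSumFree) {ι : Type}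
    {t : Finset ι} {f : ι → B} (h : S.fsum t f = S.zero) {i : ι} (hi : i ∈ t) :
    f i = S.zero := by
  classical
  rw [← Finset.insert_erase hi, S.fsum_insert (Finset.notMem_erase i t)] at h
  exact (hS _ _ h).1

/-- If left and right multiplication by `a` and `c` reflects non-vanishing of binary sums to the
summands, then it does so for finite sums. -/
theorem exists_mul_mul_ne_zero_of_fsum {a c : B}
    (hac : ∀ b b', S.mul (S.mul a (S.add b b')) c ≠ S.zero →
      S.mul (S.mul a b) c ≠ S.zero ∨ S.mul (S.mul a b') c ≠ S.zero)
    {ι : Type} {t : Finset ι} {f : ι → B} (h : S.mul (S.mul a (S.fsum t f)) c ≠ S.zero) :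
    ∃ i, S.mul (S.mul a (f i)) c ≠ S.zero := by
  classical
  induction t using Finset.induction_on with
  | empty => simp [fsum_empty, S.mul_zero, S.zero_mul] at h
  | insert i t hi ih =>
    rw [S.fsum_insert hi] at h
    exact (hac _ _ h).elim (fun h => ⟨i, h⟩) ih

theorem finProd_eq_one {n : ℕ} {f : Fin n → B} (h : ∀ i, f i = S.one) : S.finProd f = S.one := by
  induction n with
  | zero => rfl
  | succ n ih => simp [finProd, h, ih, S.mul_one]

theorem finProd_eq_of_pos {n : ℕ} (hn : 0 < n) {f : Fin n → B} {x : B}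
    (h : ∀ i, f i = if i.val = 0 then x else S.one) : S.finProd f = x := by
  obtain ⟨n, rfl⟩ := Nat.exists_eq_add_of_lt hn
  simp [finProd, h, finProd_eq_one, S.mul_one]

theorem finProd_eq_mul {n : ℕ} (hn : 2 ≤ n) {f : Fin n → B} {x y : B}
    (h : ∀ i, f i = if i.val = 0 then x else if i.val = 1 then y else S.one) :
    S.finProd f = S.mul x y := by
  obtain ⟨n, rfl⟩ := Nat.exists_eq_add_of_le' hn
  have : S.finProd (fun i : Fin (n + 1) => f i.succ) = y :=
    S.finProd_eq_of_pos n.succ_pos (fun i => by simp [h])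
  simp only [finProd] at this ⊢
  rw [this]
  simp [h]

/-- Factors of a product can be replaced, one after the other, by values from prescribed sets
while the product stays non-zero in a given context. -/
theorem exists_finProd_ne_zero {n : ℕ} {M : B → Prop} (hM : (∀ a, M a) ∨ n ≤ 1) {f : Fin n → B}
    {W : Fin n → B → Prop}
    (hW : ∀ i a c, M a → S.mul (S.mul a (f i)) c ≠ S.zero →
      ∃ w, W i w ∧ S.mul (S.mul a w) c ≠ S.zero)
    {a c : B} (ha : M a) (h : S.mul (S.mul a (S.finProd f)) c ≠ S.zero) :
    ∃ g : Fin n → B, (∀ i, W i (g i)) ∧ S.mul (S.mul a (S.finProd g)) c ≠ S.zero := by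
  induction n generalizing a with
  | zero => exact ⟨f, fun i => i.elim0, h⟩
  | succ n ih =>
    have h1 : S.mul (S.mul a (f 0)) (S.mul (S.finProd fun i => f i.succ) c) ≠ S.zero := by
      simpa only [finProd, S.mul_assoc] using h
    obtain ⟨w, hw, h2⟩ := hW 0 _ _ ha h1
    rw [← S.mul_assoc] at h2
    obtain ⟨g, hg, h3⟩ : ∃ g : Fin n → B, (∀ i, W i.succ (g i)) ∧
        S.mul (S.mul (S.mul a w) (S.finProd g)) c ≠ S.zero := by
      rcases hM with hM | hn
      · exact ih (.inl hM) (fun i => hW i.succ) (hM _) h2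
      · obtain rfl : n = 0 := by omega
        exact ⟨fun i => f i.succ, fun i => i.elim0, h2⟩
    refine ⟨Fin.cons w g, Fin.cases hw hg, ?_⟩
    simpa [finProd, S.mul_assoc] using h3

end StrongBimonoid

section TreeAutomata

variable {B σ : Type} {rk : σ → ℕ} (S : StrongBimonoid B)

theorem treeH_node {Q : Type} [Fintype Q] (δ : (s : σ) → (Fin (rk s) → Q) → Q → B) (s : σ)
    (ts : Fin (rk s) → RTree σ rk) (q : Q) :
    treeH S δ (.node s ts) q = S.fsum Finset.univ fun qs =>
      S.mul (S.finProd fun i => treeH S δ (ts i) (qs i)) (δ s qs q) := by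
  rw [treeH]

theorem treeWt_node {Q : Type} (δ : (s : σ) → (Fin (rk s) → Q) → Q → B) (s : σ)
    (ts : Fin (rk s) → RTree σ rk) (q : Q) (rs : ∀ i, TreeRun σ rk Q (ts i)) :
    treeWt S δ (.node s ts) (.node q rs) =
      S.mul (S.finProd fun i => treeWt S δ (ts i) (rs i)) (δ s (fun i => (rs i).root) q) :=
  rfl

theorem exists_run_of_mul_treeH_ne_zero {Q : Type} [Fintype Q]
    {δ : (s : σ) → (Fin (rk s) → Q) → Q → B} {M : B → Prop}
    (hM : (∀ a, M a) ∨ ∀ s, rk s ≤ 1)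
    (hadd : ¬ RankTrivial rk → ∀ a, M a → ∀ b b' c,
      S.mul (S.mul a (S.add b b')) c ≠ S.zero →
        S.mul (S.mul a b) c ≠ S.zero ∨ S.mul (S.mul a b') c ≠ S.zero)
    (t : RTree σ rk) (q : Q) (a c : B) (ha : M a)
    (h : S.mul (S.mul a (treeH S δ t q)) c ≠ S.zero) :
    ∃ ρ : TreeRun σ rk Q t, ρ.root = q ∧ S.mul (S.mul a (treeWt S δ t ρ)) c ≠ S.zero := by
  induction t generalizing q a c with
  | node s ts ih =>
    obtain ⟨qs, hqs⟩ : ∃ qs : Fin (rk s) → Q,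
        S.mul (S.mul a (S.mul (S.finProd fun i => treeH S δ (ts i) (qs i)) (δ s qs q))) c
          ≠ S.zero := by
      rw [treeH_node] at h
      by_cases hs : rk s = 0
      · have : IsEmpty (Fin (rk s)) := by rw [hs]; infer_instance
        rw [S.fsum_eq_single (fun i => isEmptyElim i) (fun j hj => (hj (Subsingleton.elim _ _)).elim)] at h
        exact ⟨_, h⟩
      · exact S.exists_mul_mul_ne_zero_of_fsum
          (fun b b' => hadd (fun hT => hs (hT s)) a ha b b' c) h
    have h1 : S.mul (S.mul a (S.finProd fun i => treeH S δ (ts i) (qs i)))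
        (S.mul (δ s qs q) c) ≠ S.zero := by
      simpa only [S.mul_assoc] using hqs
    obtain ⟨g, hg, h2⟩ := S.exists_finProd_ne_zero (hM.imp_right fun h => h s)
      (W := fun i w => ∃ ρ : TreeRun σ rk Q (ts i), ρ.root = qs i ∧ treeWt S δ (ts i) ρ = w)
      (fun i a c ha h => by
        obtain ⟨ρ, hρ, hne⟩ := ih i (qs i) a c ha h
        exact ⟨_, ⟨ρ, hρ, rfl⟩, hne⟩) ha h1
    choose rs hroot hwt using hg
    refine ⟨.node q rs, rfl, ?_⟩
    simpa only [treeWt_node, hroot, hwt, S.mul_assoc] using h2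

theorem treeRunSem_ne_zero_of_treeInitSem_ne_zero {Q : Type} [Fintype Q]
    {δ : (s : σ) → (Fin (rk s) → Q) → Q → B} {F : Q → B} (hS : S.ZeroSumFree)
    (hright : ¬ RankTrivial rk → ∀ b b' c : B, S.mul (S.add b b') c ≠ S.zero →
      (S.mul b c ≠ S.zero ∨ S.mul b' c ≠ S.zero))
    (hboth : RankBranching rk → ∀ a b b' c : B, S.mul (S.mul a (S.add b b')) c ≠ S.zero →
      (S.mul (S.mul a b) c ≠ S.zero ∨ S.mul (S.mul a b') c ≠ S.zero))
    {t : RTree σ rk} (h : treeInitSem S δ F t ≠ S.zero) : treeRunSem S δ F t ≠ S.zero := by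
  obtain ⟨q, -, hq⟩ := S.exists_ne_zero_of_fsum_ne_zero h
  obtain ⟨ρ, hρ, hne⟩ := exists_run_of_mul_treeH_ne_zero S
    (M := fun a => RankBranching rk ∨ a = S.one)
    (by
      by_cases hb : RankBranching rk
      · exact .inl fun _ => .inl hb
      · refine .inr fun s => ?_
        by_contra hs
        exact hb ⟨s, by omega⟩)
    (by
      rintro hT a (hb | rfl) b b' c h
      · exact hboth hb a b b' c h
      · simp only [S.one_mul] at h ⊢
        exact hright hT b b' c h)
    t q S.one (F q) (.inr rfl) (by rwa [S.one_mul])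
  rw [S.one_mul, ← hρ] at hne
  exact fun h0 => hne (hS.eq_zero_of_fsum_eq_zero h0 (Finset.mem_univ ρ))

/-- The state vector `(x, y, e, e, …)` of length `n`. -/
def stateVec {Q : Type} (n : ℕ) (x y e : Q) : Fin n → Q :=
  fun i => if i.val = 0 then x else if i.val = 1 then y else e

/-- The weights of the leaves in the automaton `witnessDelta`. -/
def witnessLeaf (a b b' : B) : Fin 6 → B := ![a, b, b', S.one, S.zero, S.zero]

open Classical in
/-- Transitions of an automaton that, in state `4`, sums up the leaf weights `b` and `b'`
and, in state `5`, multiplies this sum on the left by the leaf weight `a`. -/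
def witnessDelta (rk : σ → ℕ) (a b b' : B) (s : σ) (qs : Fin (rk s) → Fin 6) (q : Fin 6) : B :=
  if rk s = 0 then witnessLeaf S a b b' q
  else if q = 4 ∧ (qs = stateVec (rk s) 1 3 3 ∨ qs = stateVec (rk s) 2 3 3) ∨
      q = 5 ∧ qs = stateVec (rk s) 0 4 3 then S.one
  else S.zero

/-- The tree consisting of a single nullary symbol. -/
abbrev leafTree {s : σ} (hs : rk s = 0) : RTree σ rk :=
  .node s fun i => (Fin.cast hs i).elim0

variable {S} {s₀ s : σ} (hs₀ : rk s₀ = 0) {a b b' : B}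

theorem treeH_leafTree (q : Fin 6) :
    treeH S (witnessDelta S rk a b b') (leafTree hs₀) q = witnessLeaf S a b b' q := by
  have : IsEmpty (Fin (rk s₀)) := by rw [hs₀]; infer_instance
  rw [leafTree, treeH_node, S.fsum_eq_single (fun i => isEmptyElim i)
    (fun j hj => (hj (Subsingleton.elim _ _)).elim), S.finProd_eq_one fun i => isEmptyElim i, S.one_mul,
    witnessDelta, if_pos hs₀]

theorem treeWt_leafTree {t : RTree σ rk} (ht : t = leafTree hs₀) (ρ : TreeRun σ rk (Fin 6) t) :
    treeWt S (witnessDelta S rk a b b') t ρ = witnessLeaf S a b b' ρ.root := by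
  subst ht
  have : IsEmpty (Fin (rk s₀)) := by rw [hs₀]; infer_instance
  cases ρ with
  | node q rs =>
    rw [treeWt_node, S.finProd_eq_one fun i => isEmptyElim i, S.one_mul, witnessDelta, if_pos hs₀]
    rfl

theorem finProd_witnessLeaf (hs : 0 < rk s) (p : Fin 6) :
    S.finProd (fun i => witnessLeaf S a b b' (stateVec (rk s) p 3 3 i)) =
      witnessLeaf S a b b' p :=
  S.finProd_eq_of_pos hs fun i => by
    by_cases hi : i.val = 0 <;> simp [stateVec, hi, witnessLeaf]

theorem treeH_node_leafTree (hs : 0 < rk s) :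
    treeH S (witnessDelta S rk a b b') (.node s fun _ => leafTree hs₀) 4 = S.add b b' := by
  have hs' : rk s ≠ 0 := hs.ne'
  have h12 : stateVec (rk s) (1 : Fin 6) 3 3 ≠ stateVec (rk s) 2 3 3 := fun h => by
    simpa [stateVec] using congrFun h ⟨0, hs⟩
  rw [treeH_node]
  simp only [treeH_leafTree]
  rw [S.fsum_eq_add _ _ h12]
  · simp only [finProd_witnessLeaf hs]
    simp [witnessDelta, hs', witnessLeaf, S.mul_one]
  · rintro qs ⟨h1, h2⟩
    simp [witnessDelta, hs', h1, h2, S.mul_zero]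

theorem treeWt_node_leafTree (hs : 0 < rk s) {t : RTree σ rk}
    (ht : t = .node s fun _ => leafTree hs₀)
    (ρ : TreeRun σ rk (Fin 6) t) (hρ : ρ.root = 4) :
    treeWt S (witnessDelta S rk a b b') t ρ = b ∨
      treeWt S (witnessDelta S rk a b b') t ρ = b' ∨
      treeWt S (witnessDelta S rk a b b') t ρ = S.zero := by
  subst ht
  have hs' : rk s ≠ 0 := hs.ne'
  cases ρ with
  | node q rs =>
    obtain rfl : q = 4 := hρ
    simp only [treeWt_node, treeWt_leafTree hs₀ rfl]
    generalize hqs : (fun i => (rs i).root) = qs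
    simp only [fun i => congrFun hqs i]
    by_cases h1 : qs = stateVec (rk s) 1 3 3
    · subst h1
      rw [finProd_witnessLeaf hs]
      simp [witnessDelta, hs', witnessLeaf, S.mul_one]
    by_cases h2 : qs = stateVec (rk s) 2 3 3
    · subst h2
      rw [finProd_witnessLeaf hs]
      simp [witnessDelta, hs', witnessLeaf, S.mul_one]
    simp [witnessDelta, hs', h1, h2, S.mul_zero]

/-- The tree `s(s₀, s(s₀, …, s₀), s₀, …, s₀)`. -/
abbrev nestedTree (s : σ) : RTree σ rk :=
  .node s fun i => if i.val = 1 then .node s fun _ => leafTree hs₀ else leafTree hs₀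

theorem treeH_nestedTree (hs : 2 ≤ rk s) :
    treeH S (witnessDelta S rk a b b') (nestedTree hs₀ s) 5 = S.mul a (S.add b b') := by
  have hs' : rk s ≠ 0 := by omega
  rw [nestedTree, treeH_node, S.fsum_eq_single (stateVec (rk s) 0 4 3)]
  · rw [S.finProd_eq_mul hs (x := a) (y := S.add b b')]
    · simp [witnessDelta, hs', S.mul_one]
    · intro i
      by_cases h0 : i.val = 0
      · simp [stateVec, h0, treeH_leafTree, witnessLeaf]
      by_cases h1 : i.val = 1
      · simp [stateVec, h1, treeH_node_leafTree hs₀ (show 0 < rk s by omega)]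
      simp [stateVec, h0, h1, treeH_leafTree, witnessLeaf]
  · intro qs h
    simp [witnessDelta, hs', h, S.mul_zero]

theorem treeWt_nestedTree (hs : 2 ≤ rk s)
    (ρ : TreeRun σ rk (Fin 6) (nestedTree hs₀ s)) (hρ : ρ.root = 5) :
    treeWt S (witnessDelta S rk a b b') _ ρ = S.mul a b ∨
      treeWt S (witnessDelta S rk a b b') _ ρ = S.mul a b' ∨
      treeWt S (witnessDelta S rk a b b') _ ρ = S.zero := by
  have hs' : rk s ≠ 0 := by omega
  cases ρ with
  | node q rs =>
    obtain rfl : q = 5 := hρ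
    by_cases h : (fun i => (rs i).root) = stateVec (rk s) 0 4 3
    swap
    · simp [treeWt_node, witnessDelta, hs', h, S.mul_zero]
    rw [treeWt_node, S.finProd_eq_mul hs (x := a)
      (y := treeWt S (witnessDelta S rk a b b') _ (rs ⟨1, hs⟩)), h]
    · have h1 := treeWt_node_leafTree (S := S) (a := a) (b := b) (b' := b') hs₀
        (show 0 < rk s by omega) (if_pos rfl) (rs ⟨1, hs⟩) (congrFun h ⟨1, hs⟩)
      simp only [witnessDelta, hs', if_false, true_and, or_true, if_true, S.mul_one]
      rcases h1 with h1 | h1 | h1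
      · exact .inl (congrArg _ h1)
      · exact .inr (.inl (congrArg _ h1))
      · exact .inr (.inr ((congrArg _ h1).trans (S.mul_zero a)))
    · intro i
      by_cases h1 : i.val = 1
      · obtain rfl : i = ⟨1, hs⟩ := Fin.ext h1
        simp
      rw [treeWt_leafTree hs₀ (if_neg h1), congrFun h i]
      by_cases h0 : i.val = 0 <;> simp [stateVec, h0, h1, witnessLeaf]

/-- If the support of the initial algebra semantics is contained in that of the run semantics,
then a non-zero `treeH` value in context yields a run of non-zero weight in the same context. -/
theorem exists_run_of_support_subset
    (hsupp : ∀ (Q : Type) [Fintype Q] [Nonempty Q]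
      (δ : (s : σ) → (Fin (rk s) → Q) → Q → B) (F : Q → B),
      {t : RTree σ rk | treeInitSem S δ F t ≠ S.zero} ⊆
        {t : RTree σ rk | treeRunSem S δ F t ≠ S.zero})
    {Q : Type} [Fintype Q]
    {δ : (s : σ) → (Fin (rk s) → Q) → Q → B} {t : RTree σ rk} {q : Q} {c : B}
    (h : S.mul (treeH S δ t q) c ≠ S.zero) :
    ∃ ρ : TreeRun σ rk Q t, ρ.root = q ∧ S.mul (treeWt S δ t ρ) c ≠ S.zero := by
  classical
  have : Nonempty Q := ⟨q⟩
  have hinit : treeInitSem S δ (fun p => if p = q then c else S.zero) t ≠ S.zero := by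
    rw [treeInitSem, S.fsum_eq_single q (fun p hp => by simp [hp, S.mul_zero])]
    simpa using h
  obtain ⟨ρ, -, hρ⟩ := S.exists_ne_zero_of_fsum_ne_zero (hsupp Q δ _ hinit)
  by_cases hq : ρ.root = q
  · exact ⟨ρ, hq, by simpa [hq] using hρ⟩
  · simp [hq, S.mul_zero] at hρ

end TreeAutomata

theorem stmt15 {B : Type} (S : StrongBimonoid B)
    (σt : Type) [Fintype σt] [Nonempty σt] (rk : σt → ℕ) (h0 : ∃ s, rk s = 0)
    (hzsf : S.ZeroSumFree) :
    ((¬ RankTrivial rk →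
        ∀ b b' c : B, S.mul (S.add b b') c ≠ S.zero →
          (S.mul b c ≠ S.zero ∨ S.mul b' c ≠ S.zero)) ∧
      (RankBranching rk →
        ∀ a b b' c : B, S.mul (S.mul a (S.add b b')) c ≠ S.zero →
          (S.mul (S.mul a b) c ≠ S.zero ∨ S.mul (S.mul a b') c ≠ S.zero))) ↔
      (∀ (Q : Type) [Fintype Q] [Nonempty Q] (δ : (s : σt) → (Fin (rk s) → Q) → Q → B) (F : Q → B),
        {t : RTree σt rk | treeInitSem S δ F t ≠ S.zero} ⊆
          {t : RTree σt rk | treeRunSem S δ F t ≠ S.zero}) := by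
  constructor
  · rintro ⟨hright, hboth⟩ Q _ _ δ F t ht
    exact treeRunSem_ne_zero_of_treeInitSem_ne_zero S hzsf hright hboth ht
  · intro hsupp
    obtain ⟨s₀, hs₀⟩ := h0
    constructor
    · intro hT b b' c h
      obtain ⟨s, hs⟩ := not_forall.mp hT
      replace hs := Nat.pos_of_ne_zero hs
      rw [← treeH_node_leafTree (S := S) (a := S.one) hs₀ hs] at h
      obtain ⟨ρ, hroot, hρ⟩ := exists_run_of_support_subset hsupp h
      rcases treeWt_node_leafTree hs₀ hs rfl ρ hroot with hw | hw | hw <;> rw [hw] at hρ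
      · exact .inl hρ
      · exact .inr hρ
      · exact (hρ (S.zero_mul c)).elim
    · rintro ⟨s, hs⟩ a b b' c h
      rw [← treeH_nestedTree (S := S) hs₀ hs] at h
      obtain ⟨ρ, hroot, hρ⟩ := exists_run_of_support_subset hsupp h
      rcases treeWt_nestedTree hs₀ hs ρ hroot with hw | hw | hw <;> rw [hw] at hρ
      · exact .inl hρ
      · exact .inr hρ
      · exact (hρ (S.zero_mul c)).elim
end
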